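/- Let G be a finite simple graph with a block contig (r, β) on ZMod n, let a ≠ b be points that are non-adjacent in 𝒢(r), and let v ∈ β⁻¹(a) and w ∈ β⁻¹(b). If the graph G + vw is a PIG graph, then either (i) both ⟨a, b⟩ and ⟨b, a⟩ are almost-connectable, or (ii) at least one of ⟨a, b⟩ and ⟨b, a⟩ is connectable. -/

import Mathlib

open Classical

noncomputable section

def IsRoundRep (n : ℕ) (r : ZMod n → ℕ) : Prop :=
  (∀ i, r i < n) ∧ (∀ i, r i ≤ r (i + 1) + 1)

def Arrow {n : ℕ} (r : ZMod n → ℕ) (i j : ZMod n) : Prop :=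
  ∃ k : ℕ, 1 ≤ k ∧ k ≤ r i ∧ j = i + (k : ZMod n)

def Fr {n : ℕ} (r : ZMod n → ℕ) (i : ZMod n) : ZMod n := i + (r i : ZMod n)

def Fl {n : ℕ} (r : ZMod n → ℕ) (i : ZMod n) : ZMod n :=
  i - (({j : ZMod n | Arrow r j i}).ncard : ZMod n)

def Nr {n : ℕ} (r : ZMod n → ℕ) (i : ZMod n) : ZMod n :=
  if Arrow r i (i + 1) then i + 1 else i

def Nl {n : ℕ} (r : ZMod n → ℕ) (i : ZMod n) : ZMod n :=
  if Arrow r (i - 1) i then i - 1 else i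

def Ur {n : ℕ} (r : ZMod n → ℕ) (i : ZMod n) : ZMod n := Fr r i + 1

def Ul {n : ℕ} (r : ZMod n → ℕ) (i : ZMod n) : ZMod n := Fl r i - 1

def IsNormal {n : ℕ} (r : ZMod n → ℕ) : Prop :=
  ∀ i j : ZMod n, i ≠ j → ¬(Arrow r i j ∧ Arrow r j i)

def roundGraph {n : ℕ} (r : ZMod n → ℕ) : SimpleGraph (ZMod n) :=
  SimpleGraph.fromRel (Arrow r)

def IsStraight {n : ℕ} (r : ZMod n → ℕ) : Prop := ∃ i, r i = 0

def cyclicRange {n : ℕ} (a b : ZMod n) : Set (ZMod n) :=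
  {x | ∃ k : ℕ, k ≤ (b - a).val ∧ x = a + (k : ZMod n)}

def cyclicRangeCO {n : ℕ} (a b : ZMod n) : Set (ZMod n) := cyclicRange a b \ {b}

def cyclicRangeOC {n : ℕ} (a b : ZMod n) : Set (ZMod n) := cyclicRange a b \ {a}

def cyclicRangeOO {n : ℕ} (a b : ZMod n) : Set (ZMod n) := cyclicRange a b \ {a, b}

def coNbhd {V : Type*} (G : SimpleGraph V) (v : V) : Set V :=
  {w | w ≠ v ∧ ¬ G.Adj v w}

def coNbhdSet {V : Type*} (G : SimpleGraph V) (S : Set V) : Set V :=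
  ⋃ v ∈ S, coNbhd G v

def IsBipartite {V : Type*} (G : SimpleGraph V) : Prop :=
  ∃ S : Set V, ∀ v w, G.Adj v w → (v ∈ S ↔ w ∉ S)

def IsUniversalPt {n : ℕ} (r : ZMod n → ℕ) (i : ZMod n) : Prop :=
  ∀ j, j ≠ i → (roundGraph r).Adj i j

def Compressed {n : ℕ} (r : ZMod n → ℕ) : Prop :=
  ∀ i j : ZMod n, Fl r i = Fl r j → Fr r i = Fr r j → i = j

def IsRoundRepOf {V : Type*} (G : SimpleGraph V) (n : ℕ) (r : ZMod n → ℕ)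
    (β : V → ZMod n) : Prop :=
  IsRoundRep n r ∧ IsNormal r ∧ Function.Surjective β ∧
    ∀ u v : V, u ≠ v → (G.Adj u v ↔ (β u = β v ∨ (roundGraph r).Adj (β u) (β v)))

def IsPCA {V : Type*} (G : SimpleGraph V) : Prop :=
  ∃ n : ℕ, 1 ≤ n ∧ ∃ (r : ZMod n → ℕ) (β : V → ZMod n), IsRoundRepOf G n r β

def IsPIG {V : Type*} (G : SimpleGraph V) : Prop :=
  ∃ n : ℕ, 1 ≤ n ∧ ∃ (r : ZMod n → ℕ) (β : V → ZMod n),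
    IsRoundRepOf G n r β ∧ IsStraight r

def IsBlockContigOf {V : Type*} (G : SimpleGraph V) (n : ℕ) (r : ZMod n → ℕ)
    (β : V → ZMod n) : Prop :=
  IsRoundRepOf G n r β ∧ Compressed r ∧
    {i : ZMod n | IsUniversalPt r i}.Subsingleton ∧ (roundGraph r).Connected

def Disconnectable {n : ℕ} (r : ZMod n → ℕ) (a b : ZMod n) : Prop :=
  b = Fr r a ∧ a = Fl r b

def Connectable {n : ℕ} (r : ZMod n → ℕ) (a b : ZMod n) : Prop :=
  b = Ur r a ∧ a = Ul r b

def addEdge {V : Type*} (G : SimpleGraph V) (v w : V) : SimpleGraph V :=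
  G ⊔ SimpleGraph.fromRel (fun x y => x = v ∧ y = w)

def IsCoContigChunk {n : ℕ} (r : ZMod n → ℕ) (S : Set (ZMod n)) : Prop :=
  (∃ a b : ZMod n, S = cyclicRange a b) ∧
  ∃ X : Set (ZMod n), S ⊆ X ∧
    (∃ C : ((roundGraph r)ᶜ).ConnectedComponent,
      X ∪ coNbhdSet (roundGraph r) X = C.supp) ∧
    X ∩ coNbhdSet (roundGraph r) X = ∅ ∧
    (roundGraph r).IsClique X ∧ (roundGraph r).IsClique (coNbhdSet (roundGraph r) X)

def phi {n : ℕ} (w : ZMod (n + 1)) (k : ZMod n) : ZMod (n + 1) :=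
  w + 1 + (k.val : ZMod (n + 1))

def removePt {n : ℕ} (s : ZMod (n + 1) → ℕ) (w : ZMod (n + 1)) (k : ZMod n) : ℕ :=
  if Arrow s (phi w k) w then s (phi w k) - 1 else s (phi w k)

def Receptive {n : ℕ} (r : ZMod n → ℕ) (Bl Br : ZMod n) : Prop :=
  ∃ (s : ZMod (n + 1) → ℕ) (w : ZMod (n + 1)),
    IsRoundRep (n + 1) s ∧ IsNormal s ∧ (roundGraph s).Connected ∧
    Fl s w ≠ w ∧ Fr s w ≠ w ∧ removePt s w = r ∧
    phi w Bl = Fl s w ∧ phi w Br = Fr s w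

def dominoGraph : SimpleGraph (Fin 6) :=
  SimpleGraph.fromRel (fun i j =>
    (i, j) = (0, 1) ∨ (i, j) = (1, 2) ∨ (i, j) = (3, 4) ∨ (i, j) = (4, 5) ∨
    (i, j) = (0, 3) ∨ (i, j) = (1, 4) ∨ (i, j) = (2, 5))

def pGraph : SimpleGraph (Fin 5) :=
  SimpleGraph.fromRel (fun i j =>
    (i, j) = (0, 1) ∨ (i, j) = (1, 2) ∨ (i, j) = (3, 4) ∨
    (i, j) = (0, 3) ∨ (i, j) = (1, 4))

def AlmostConnectable {V : Type*} {n : ℕ} (r : ZMod n → ℕ) (β : V → ZMod n)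
    (a b : ZMod n) : Prop :=
  (∃ v : V, β ⁻¹' {a} = {v}) ∧ (∃ w : V, β ⁻¹' {b} = {w}) ∧
  ∃ (hab : a ≠ b) (C : (((roundGraph r).induce {x : ZMod n | x ≠ b})ᶜ).ConnectedComponent)
    (D : Set (ZMod n)),
      (⟨a, hab⟩ : {x : ZMod n | x ≠ b}) ∈ C.supp ∧
      D = Subtype.val '' C.supp ∧
      Nonempty ((roundGraph r).induce D ≃g pGraphᶜ) ∧
      Nonempty ((roundGraph r).induce (D ∪ {b}) ≃g dominoGraphᶜ) ∧
      Nonempty ((roundGraph r).induce ((D ∪ {b}) \ {a}) ≃g pGraphᶜ)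

/-- A reflexive symmetric relation whose points can be placed on a line so that related points
are related to everything in between. -/
structure Umbrella {X : Type*} (E : X → X → Prop) (f : X → ℤ) : Prop where
  refl : ∀ x, E x x
  symm : ∀ x y, E x y → E y x
  left : ∀ x y z, f x ≤ f y → f y ≤ f z → E x z → E x y
  right : ∀ x y z, f x ≤ f y → f y ≤ f z → E x z → E y z

namespace Umbrella

variable {X : Type*} {E : X → X → Prop} {f : X → ℤ}

theorem neg (h : Umbrella E f) : Umbrella E (fun x => - f x) where
  refl := h.refl
  symm := h.symm
  left x y z h1 h2 h3 := h.symm _ _ (h.right z y x (by simpa using h2) (by simpa using h1) (h.symm _ _ h3))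
  right x y z h1 h2 h3 := h.symm _ _ (h.left z y x (by simpa using h2) (by simpa using h1) (h.symm _ _ h3))

theorem no_claw (h : Umbrella E f) {c x y z : X} (hx : E c x) (hy : E c y) (hz : E c z)
    (hxy : ¬ E x y) (hyz : ¬ E y z) (hxz : ¬ E x z) : False := by
  have hs := h.symm
  have hl := h.left
  have hr := h.right
  rcases le_total (f x) (f y) with h1 | h1 <;> rcases le_total (f y) (f z) with h2 | h2 <;>
  rcases le_total (f x) (f z) with h3 | h3 <;> rcases le_total (f c) (f x) with h4 | h4 <;>
  rcases le_total (f c) (f y) with h5 | h5 <;> rcases le_total (f c) (f z) with h6 | h6 <;>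
  grind

theorem no_square (h : Umbrella E f) {x y z w : X} (hxy : E x y) (hyz : E y z) (hzw : E z w)
    (hwx : E w x) (hxz : ¬ E x z) (hyw : ¬ E y w) : False := by
  have hs := h.symm
  have hl := h.left
  have hr := h.right
  rcases le_total (f x) (f z) with h1 | h1 <;> rcases le_total (f y) (f w) with h2 | h2 <;>
  rcases le_total (f x) (f y) with h3 | h3 <;> rcases le_total (f z) (f w) with h4 | h4 <;>
  rcases le_total (f x) (f w) with h5 | h5 <;> rcases le_total (f z) (f y) with h6 | h6 <;>
  grind

/-- The leftmost of finitely many points has a clique as neighbourhood. -/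
theorem exists_simplicial (h : Umbrella E f) (s : Finset X) (hs : s.Nonempty) :
    ∃ x ∈ s, ∀ y ∈ s, ∀ z ∈ s, E x y → E x z → E y z := by
  obtain ⟨x, hx, hmin⟩ := s.exists_min_image f hs
  refine ⟨x, hx, fun y hy z hz h1 h2 => ?_⟩
  rcases le_total (f y) (f z) with h3 | h3
  · exact h.right x y z (hmin y hy) h3 h2
  · exact h.symm _ _ (h.right x z y (hmin z hz) h3 h1)

theorem no_pentagon (h : Umbrella E f) {x y z w u : X} (hxy : E x y) (hyz : E y z) (hzw : E z w)
    (hwu : E w u) (hux : E u x) (hxz : ¬ E x z) (hyw : ¬ E y w) (hzu : ¬ E z u) (hwx : ¬ E w x)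
    (huy : ¬ E u y) : False := by
  obtain ⟨p, hp, H⟩ := h.exists_simplicial {x, y, z, w, u} (by simp)
  have hs := h.symm
  simp only [Finset.mem_insert, Finset.mem_singleton, forall_eq_or_imp, forall_eq] at hp H
  rcases hp with rfl | rfl | rfl | rfl | rfl <;> grind

end Umbrella

/-- The points `π i` lie on a circle of circumference `N`, `T i j` says that the arc starting at
`i` reaches `j`, and `E` is the adjacency relation of these arcs together with the additional
pair `π 0`, `π d`. -/
structure ArcConf {X : Type*} (N d : ℤ) (T : ℤ → ℤ → Prop) (π : ℤ → X) (E : X → X → Prop)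
    (f : X → ℤ) : Prop where
  umb : Umbrella E f
  pos : 0 < d
  lt : d < N
  surj : ∀ x, ∃ i, 0 ≤ i ∧ i < N ∧ π i = x
  per : ∀ i, π (i + N) = π i
  inj : ∀ i j, i ≤ j → j < i + N → π i = π j → i = j
  le_of : ∀ i j, T i j → i ≤ j
  mono : ∀ i j k l, T i l → i ≤ j → j ≤ k → k ≤ l → T j k
  shift : ∀ i j, T (i + N) (j + N) ↔ T i j
  no_left : ¬ T 0 d
  no_right : ¬ T d N
  compressed : ∀ i, T i (i + 1) →
    (∃ j, T (i + 1) j ∧ ¬ T i j) ∨ ∃ j, j < i ∧ T j i ∧ ¬ T j (i + 1)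
  conn : ∀ i j, i < j → j < i + N → T i (i + 1) ∨ T j (j + 1)
  edge : E (π 0) (π d)
  of_arc : ∀ i j, T i j → E (π i) (π j)
  elim : ∀ i j, i < j → j < i + N → E (π i) (π j) →
    T i j ∨ T j (i + N) ∨ (π i = π 0 ∧ π j = π d) ∨ (π i = π d ∧ π j = π 0)

/-- The complement of `E` consists of a domino with the edge `a b` removed and isolated points. -/
def IsDominoConf {X : Type*} (E : X → X → Prop) (a b : X) : Prop :=
  ∃ p q c e : X, (¬ E a q ∧ ¬ E b p ∧ ¬ E p q ∧ ¬ E q c ∧ ¬ E c e ∧ ¬ E e p) ∧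
    (E a p ∧ E a c ∧ E a e ∧ E b q ∧ E b c ∧ E b e ∧ E p c ∧ E q e) ∧
    ∀ x, x ≠ a → x ≠ b → x ≠ p → x ≠ q → x ≠ c → x ≠ e → ∀ y, E x y

namespace ArcConf

variable {X : Type*} {N d : ℤ} {T : ℤ → ℤ → Prop} {π : ℤ → X} {E : X → X → Prop} {f : X → ℤ}

theorem swap (h : ArcConf N d T π E f) :
    ArcConf N (N - d) (fun i j => T (i + d) (j + d)) (fun i => π (i + d)) E f where
  umb := h.umb
  pos := by have := h.lt; omega
  lt := by have := h.pos; omega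
  surj x := by
    obtain ⟨i, h1, h2, h3⟩ := h.surj x
    have := h.pos
    have := h.lt
    by_cases hi : d ≤ i
    · exact ⟨i - d, by omega, by omega, by simpa using h3⟩
    · refine ⟨i - d + N, by omega, by omega, ?_⟩
      rw [← h3, ← h.per i]
      congr 1
      ring
  per i := by rw [← h.per (i + d)]; congr 1; ring
  inj i j h1 h2 h3 := by
    have := h.inj (i + d) (j + d) (by omega) (by omega) h3
    omega
  le_of i j h1 := by have := h.le_of _ _ h1; omega
  mono i j k l h1 h2 h3 h4 := h.mono _ _ _ _ h1 (by omega) (by omega) (by omega)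
  shift i j := by
    rw [← h.shift (i + d) (j + d), add_right_comm i, add_right_comm j]
  no_left := by simpa using h.no_right
  no_right := by
    have := h.no_left
    rw [← h.shift] at this
    simpa [add_comm] using this
  compressed i h1 := by
    rw [add_right_comm] at h1
    rcases h.compressed _ h1 with ⟨j, h2, h3⟩ | ⟨j, h2, h3, h4⟩
    · left
      refine ⟨j - d, ?_, ?_⟩
      · rw [add_right_comm]; simpa using h2
      · simpa using h3
    · right
      refine ⟨j - d, by omega, ?_, ?_⟩
      · simpa using h3
      · rw [add_right_comm]; simpa using h4
  conn i j h1 h2 := by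
    have := h.conn (i + d) (j + d) (by omega) (by omega)
    rwa [add_right_comm i, add_right_comm j] at this
  edge := by
    have := h.umb.symm _ _ h.edge
    rw [← h.per 0] at this
    simpa using this
  of_arc i j h1 := h.of_arc _ _ h1
  elim i j h1 h2 h3 := by
    have h4 := h.elim (i + d) (j + d) (by omega) (by omega) h3
    have h5 : π (N - d + d) = π 0 := by rw [← h.per 0]; congr 1; ring
    rw [add_right_comm i, zero_add, h5]
    tauto

theorem reflect (h : ArcConf N d T π E f) :
    ArcConf N d (fun i j => T (d - j) (d - i)) (fun i => π (d - i)) E f where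
  umb := h.umb
  pos := h.pos
  lt := h.lt
  surj x := by
    obtain ⟨i, h1, h2, h3⟩ := h.surj x
    have := h.pos
    have := h.lt
    by_cases hi : i ≤ d
    · exact ⟨d - i, by omega, by omega, by simpa using h3⟩
    · refine ⟨d - i + N, by omega, by omega, ?_⟩
      rw [← h3, ← h.per]
      congr 1
      ring
  per i := by rw [← h.per]; congr 1; ring
  inj i j h1 h2 h3 := by
    have := h.inj (d - j) (d - i) (by omega) (by omega) h3.symm
    omega
  le_of i j h1 := by have := h.le_of _ _ h1; omega
  mono i j k l h1 h2 h3 h4 := h.mono _ _ _ _ h1 (by omega) (by omega) (by omega)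
  shift i j := by
    rw [← h.shift]
    simp only [show d - (j + N) + N = d - j by ring, show d - (i + N) + N = d - i by ring]
  no_left := by simpa using h.no_left
  no_right := by
    have := h.no_right
    rw [← h.shift]
    simpa using this
  compressed i h1 := by
    have h1' : T (d - (i + 1)) (d - (i + 1) + 1) := by
      rwa [show d - (i + 1) + 1 = d - i by ring]
    rcases h.compressed _ h1' with ⟨j, h2, h3⟩ | ⟨j, h2, h3, h4⟩
    · right
      rw [show d - (i + 1) + 1 = d - i by ring] at h2
      refine ⟨d - j, ?_, by simpa using h2, by simpa using h3⟩
      have := h.le_of _ _ h2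
      by_contra hc
      exact h3 (h.mono _ _ _ _ h1 (by omega) (by omega) (by omega))
    · left
      rw [show d - (i + 1) + 1 = d - i by ring] at h4
      exact ⟨d - j, by simpa using h3, by simpa using h4⟩
  conn i j h1 h2 := by
    have := h.conn (d - (j + 1)) (d - (i + 1)) (by omega) (by omega)
    rw [show d - (i + 1) + 1 = d - i by ring, show d - (j + 1) + 1 = d - j by ring] at this
    exact this.symm
  edge := by simpa using h.umb.symm _ _ h.edge
  of_arc i j h1 := h.umb.symm _ _ (h.of_arc _ _ h1)
  elim i j h1 h2 h3 := by
    have h4 := h.elim (d - j) (d - i) (by omega) (by omega) (h.umb.symm _ _ h3)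
    rw [← h.shift (d - (i + N)) (d - j), show d - (i + N) + N = d - i by ring]
    simp only [sub_zero, sub_self]
    tauto

theorem arc_of_adj (h : ArcConf N d T π E f) {i j : ℤ} (hi : 0 ≤ i) (hij : i < j) (hj : j < N)
    (hne : i ≠ 0 ∨ j ≠ d) (hE : E (π i) (π j)) : T i j ∨ T j (i + N) := by
  have := h.pos
  have := h.lt
  rcases h.elim i j hij (by omega) hE with h1 | h1 | ⟨h1, h2⟩ | ⟨h1, h2⟩
  · exact .inl h1
  · exact .inr h1
  · have e1 := h.inj 0 i (by omega) (by omega) h1.symm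
    rcases le_total j d with hd | hd
    · have := h.inj j d hd (by omega) h2; omega
    · have := h.inj d j hd (by omega) h2.symm; omega
  · have := h.inj 0 j (by omega) (by omega) h2.symm; omega

theorem not_adj (h : ArcConf N d T π E f) {i j : ℤ} (hi : 0 ≤ i) (hij : i < j) (hj : j < N)
    (hne : i ≠ 0 ∨ j ≠ d) (h1 : ¬ T i j) (h2 : ¬ T j (i + N)) : ¬ E (π i) (π j) :=
  fun hE => (h.arc_of_adj hi hij hj hne hE).elim h1 h2

theorem adj_wrap (h : ArcConf N d T π E f) {i j : ℤ} (hT : T i (j + N)) : E (π i) (π j) := by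
  rw [← h.per j]; exact h.of_arc _ _ hT

theorem exists_common_aux (h : ArcConf N d T π E f) (hle : f (π 0) ≤ f (π d))
    (hgap : ∀ i, 0 ≤ i → i < d → T i (i + 1)) :
    ∃ m, 0 < m ∧ m < d ∧ E (π 0) (π m) ∧ E (π m) (π d) := by
  by_contra! hno
  have hs := h.umb.symm
  have key : ∀ k : ℕ, (k : ℤ) < d → f (π k) ≤ f (π 0) := by
    intro k
    induction k with
    | zero => simp
    | succ k ih =>
      intro hk
      push_cast at hk ⊢
      have ih := ih (by omega)
      have hE := h.of_arc _ _ (hgap k (by omega) (by omega))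
      by_contra! hlt
      rcases le_total (f (π (k + 1))) (f (π d)) with h1 | h1
      · exact hno (k + 1) (by omega) hk (h.umb.left _ _ _ hlt.le h1 h.edge)
          (h.umb.right _ _ _ hlt.le h1 h.edge)
      · have h2 := h.umb.right _ _ _ ih hlt.le hE
        exact hno (k + 1) (by omega) hk h2 (hs _ _ (h.umb.right _ _ _ hle h1 h2))
  have hd := h.pos
  have h1 := key (d - 1).toNat (by omega)
  rw [Int.toNat_of_nonneg (by omega)] at h1
  have h2 := hgap (d - 1) (by omega) (by omega)
  rw [sub_add_cancel] at h2
  have h3 := h.of_arc _ _ h2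
  rcases eq_or_lt_of_le (show 1 ≤ d by omega) with h4 | h4
  · subst h4
    exact h.no_left (by simpa using h2)
  · exact hno (d - 1) (by omega) (by omega) (hs _ _ (h.umb.left _ _ _ h1 hle h3)) h3

theorem neg (h : ArcConf N d T π E f) : ArcConf N d T π E (fun x => - f x) :=
  { h with umb := h.umb.neg }

theorem exists_common (h : ArcConf N d T π E f) (hgap : ∀ i, 0 ≤ i → i < d → T i (i + 1)) :
    ∃ m, 0 < m ∧ m < d ∧ T 0 m ∧ T m d := by
  have hlt := h.lt
  obtain ⟨m, h1, h2, h3, h4⟩ : ∃ m, 0 < m ∧ m < d ∧ E (π 0) (π m) ∧ E (π m) (π d) := by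
    rcases le_total (f (π 0)) (f (π d)) with hle | hle
    · exact h.exists_common_aux hle hgap
    · exact h.neg.exists_common_aux (by simpa using hle) hgap
  refine ⟨m, h1, h2, ?_, ?_⟩
  · rcases h.arc_of_adj le_rfl h1 (by omega) (by omega) h3 with h5 | h5
    · exact h5
    · exact (h.no_right (h.mono _ _ _ _ h5 (by omega) (by omega) (by omega))).elim
  · rcases h.arc_of_adj h1.le h2 (by omega) (by omega) h4 with h5 | h5
    · exact h5
    · exact (h.no_right (h.mono _ _ _ _ h5 (by omega) (by omega) (by omega))).elim

/-- If some neighbour of `π 0` between `0` and `d` is not adjacent to `π d`, then the opposite side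
holds a common neighbour of `π 0` and `π d` that does not reach `1`. -/
theorem exists_opposite (h : ArcConf N d T π E f) {m : ℤ} (hm0 : 0 < m) (hmd : m < d)
    (h0m : T 0 m) (hm : T m d) (hP : ¬ T 1 d) :
    ∃ c, d < c ∧ c < N ∧ T d c ∧ T c N ∧ ¬ T c (N + 1) := by
  have hlt := h.lt
  have hmono := h.mono
  have hnr := h.no_right
  have hnl := h.no_left
  have hm1 : 1 < m := by
    by_contra hc
    exact hP (hmono _ _ _ _ hm (by omega) (by omega) (by omega))
  have h01 : T 0 1 := hmono _ _ _ _ h0m (by omega) (by omega) (by omega)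
  have h1d : ¬ E (π 1) (π d) := h.not_adj (by omega) (by omega) hlt (by omega) hP
    fun h1 => hnr (hmono _ _ _ _ h1 (by omega) (by omega) (by omega))
  rcases h.compressed 0 (by simpa using h01) with ⟨j, h2, h3⟩ | ⟨j, h2, h3, h4⟩
  · rw [zero_add] at h2
    have h4 := h.le_of _ _ h2
    have h5 : j < d := by
      by_contra hc
      exact hP (hmono _ _ _ _ h2 (by omega) (by omega) (by omega))
    have h6 : m < j := by
      by_contra hc
      exact h3 (hmono _ _ _ _ h0m (by omega) (by omega) (by omega))
    refine (h.umb.no_square (h.of_arc _ _ h01) (h.of_arc _ _ h2)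
      (h.of_arc _ _ (hmono _ _ _ _ hm (by omega) (by omega) (by omega)))
      (h.umb.symm _ _ h.edge) ?_ h1d).elim
    exact h.not_adj le_rfl (by omega) (by omega) (by omega) h3
      fun h7 => hnr (hmono _ _ _ _ h7 (by omega) (by omega) (by omega))
  · rw [zero_add] at h4
    rw [← h.shift, zero_add] at h3
    rw [← h.shift, add_comm 1] at h4
    have h5 : d < j + N := by
      by_contra hc
      exact hnr (hmono _ _ _ _ h3 (by omega) (by omega) (by omega))
    refine ⟨j + N, h5, by omega, ?_, h3, h4⟩
    by_contra h6
    refine h.umb.no_claw (c := π 0) (x := π (j + N)) (y := π 1) (z := π d)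
      (h.umb.symm _ _ (h.adj_wrap (by simpa using h3))) (h.of_arc _ _ h01) h.edge ?_ h1d ?_
    · intro h7
      refine h.not_adj (by omega) (by omega) (by omega) (by omega) ?_ ?_ (h.umb.symm _ _ h7)
      · exact fun h8 => hP (hmono _ _ _ _ h8 (by omega) (by omega) (by omega))
      · rwa [add_comm 1]
    · intro h7
      refine h.not_adj (by omega) h5 (by omega) (by omega) h6 ?_ (h.umb.symm _ _ h7)
      exact fun h8 => h4 (hmono _ _ _ _ h8 (by omega) (by omega) (by omega))

/-- There cannot be points on both sides of `π 0` that are adjacent to `π 0` but not to `π d`. -/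
theorem no_double (h : ArcConf N d T π E f) {m l : ℤ} (hm0 : 0 < m) (hmd : m < d)
    (h0m : T 0 m) (hm : T m d) (hdl : d < l) (hlN : l < N) (hl : T d l) (hl' : T l N)
    (hP : ¬ T 1 d) (hP' : ¬ T d (N - 1)) : False := by
  have hmono := h.mono
  have hnr := h.no_right
  have hnl := h.no_left
  obtain ⟨c, hc1, hc2, hc3, hc4, hc5⟩ := h.exists_opposite hm0 hmd h0m hm hP
  obtain ⟨e, he1, he2, he3, he4, he5⟩ := h.swap.reflect.exists_opposite (m := N - l)
    (by omega) (by omega) (by simpa using hl') (by simpa using hl) (by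
      rwa [show N - d - (N - d) + d = d by ring, show N - d - 1 + d = N - 1 by ring])
  rw [show N - d - e + d = N - e by ring, show N - d - (N - d) + d = d by ring] at he3
  rw [show N - d - N + d = 0 by ring, show N - d - e + d = N - e by ring] at he4
  rw [show N - d - (N + 1) + d = -1 by ring, show N - d - e + d = N - e by ring, ← h.shift,
    show -1 + N = N - 1 by ring] at he5
  generalize hk : N - e = k at *
  have hk1 : 1 < k := by
    by_contra hc
    exact hP (hmono _ _ _ _ he3 (by omega) (by omega) (by omega))
  have hcN : c < N - 1 := by
    by_contra hc
    exact hP' (hmono _ _ _ _ hc3 (by omega) (by omega) (by omega))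
  have h01 : T 0 1 := hmono _ _ _ _ he4 (by omega) (by omega) (by omega)
  have hN : T (N - 1) N := hmono _ _ _ _ hc4 (by omega) (by omega) (by omega)
  have n1d : ¬ E (π 1) (π d) := h.not_adj (by omega) (by omega) (by omega) (by omega) hP
    fun h7 => hnr (hmono _ _ _ _ h7 (by omega) (by omega) (by omega))
  have nd : ¬ E (π d) (π (N - 1)) := h.not_adj (by omega) (by omega) (by omega) (by omega) hP'
    fun h7 => hnl <| (h.shift _ _).1 (hmono _ _ _ _ h7 (by omega) (by omega) (by omega))
  have e1 : E (π 1) (π (N - 1)) := by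
    by_contra hc
    exact h.umb.no_claw (h.of_arc _ _ h01)
      (h.umb.symm _ _ (h.adj_wrap (by simpa using hN))) h.edge hc
      (fun h7 => nd (h.umb.symm _ _ h7)) n1d
  have n1c : ¬ E (π 1) (π c) := h.not_adj (by omega) (by omega) (by omega) (by omega)
    (fun h7 => hP (hmono _ _ _ _ h7 (by omega) (by omega) (by omega)))
    (by rwa [add_comm 1])
  have nk : ¬ E (π k) (π (N - 1)) := h.not_adj (by omega) (by omega) (by omega) (by omega)
    (fun h7 => hP' (hmono _ _ _ _ h7 (by omega) (by omega) (by omega)))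
    he5
  have ek1 : E (π k) (π 1) := h.umb.symm _ _
    (h.of_arc _ _ (hmono _ _ _ _ he4 (by omega) (by omega) (by omega)))
  have ec : E (π (N - 1)) (π c) := h.umb.symm _ _
    (h.of_arc _ _ (hmono _ _ _ _ hc4 (by omega) (by omega) (by omega)))
  have edk := h.umb.symm _ _ (h.of_arc _ _ he3)
  have ecd := h.umb.symm _ _ (h.of_arc _ _ hc3)
  by_cases hck : E (π c) (π k)
  · exact h.umb.no_square hck ek1 e1 ec (fun h7 => n1c (h.umb.symm _ _ h7)) nk
  · exact h.umb.no_pentagon edk ek1 e1 ec ecd (fun h7 => n1d (h.umb.symm _ _ h7)) nk n1c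
      (fun h7 => nd (h.umb.symm _ _ h7)) hck

end ArcConf

/-- The situation in which `π 0` and `π d` have private neighbours `1` and `d + 1`. -/
structure Lonely (N d : ℤ) (T : ℤ → ℤ → Prop) : Prop where
  one : ¬ T 1 d
  one' : ¬ T (d + 1) N
  all : T 0 (d - 1)
  all' : T d (N - 1)
  ex : ∃ c, 0 < c ∧ c < d ∧ T c d ∧ ¬ T c (d + 1)
  ex' : ∃ c, d < c ∧ c < N ∧ T c N ∧ ¬ T c (N + 1)

namespace ArcConf

variable {X : Type*} {N d : ℤ} {T : ℤ → ℤ → Prop} {π : ℤ → X} {E : X → X → Prop} {f : X → ℤ}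

theorem lonely_swap (h : ArcConf N d T π E f) (hp : Lonely N d T) :
    Lonely N (N - d) (fun i j => T (i + d) (j + d)) where
  one := by
    rw [sub_add_cancel, add_comm]
    exact hp.one'
  one' := by
    rw [show N - d + 1 + d = 1 + N by ring, add_comm N d, h.shift]
    exact hp.one
  all := by
    rw [zero_add, show N - d - 1 + d = N - 1 by ring]
    exact hp.all'
  all' := by
    rw [show N - d + d = 0 + N by ring, show N - 1 + d = d - 1 + N by ring, h.shift]
    exact hp.all
  ex := by
    obtain ⟨c, h1, h2, h3, h4⟩ := hp.ex'
    refine ⟨c - d, by omega, by omega, by simpa using h3, ?_⟩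
    rwa [sub_add_cancel, show N - d + 1 + d = N + 1 by ring]
  ex' := by
    obtain ⟨c, h1, h2, h3, h4⟩ := hp.ex
    refine ⟨c - d + N, by omega, by omega, ?_, ?_⟩
    · rwa [show c - d + N + d = c + N by ring, add_comm N d, h.shift]
    · rwa [show c - d + N + d = c + N by ring, show N + 1 + d = d + 1 + N by ring, h.shift]

theorem arc_of_reach (h : ArcConf N d T π E f) (hp : Lonely N d T) {x c : ℤ} (hx1 : 1 < x)
    (hxd : x < d) (hx : T x d) (hdc : d < c) (hcN : c < N) (hc : T c (N + 1)) :
    T x c ∨ T c (x + N) := by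
  have hmono := h.mono
  refine h.arc_of_adj (by omega) (by omega) hcN (by omega) ?_
  by_contra hxc
  refine h.umb.no_square (x := π 1) (y := π x) (z := π d) (w := π c) ?_ (h.of_arc _ _ hx) ?_ ?_
    ?_ hxc
  · exact h.of_arc _ _ (hmono _ _ _ _ hp.all (by omega) (by omega) (by omega))
  · exact h.of_arc _ _ (hmono _ _ _ _ hp.all' (by omega) (by omega) (by omega))
  · exact h.adj_wrap (by rwa [add_comm 1])
  · exact h.not_adj (by omega) (by omega) h.lt (by omega) hp.one
      fun h1 => h.no_right (hmono _ _ _ _ h1 (by omega) (by omega) (by omega))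

theorem exists_of_compressed (h : ArcConf N d T π E f) {i : ℤ} (hi : 0 < i)
    (h0 : T 0 (i + 1)) (hT : ∀ j, T (i + 1) j → ¬ T i j → False) :
    ∃ c, d < c ∧ c < N ∧ T c (i + N) ∧ ¬ T c (i + 1 + N) := by
  have hmono := h.mono
  rcases h.compressed i (hmono _ _ _ _ h0 (by omega) (by omega) (by omega)) with
    ⟨j, h1, h2⟩ | ⟨j, h1, h2, h3⟩
  · exact (hT j h1 h2).elim
  · have hj : j < 0 := by
      by_contra hc
      exact h3 (hmono _ _ _ _ h0 (by omega) (by omega) (by omega))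
    rw [← h.shift] at h2 h3
    refine ⟨j + N, ?_, by omega, h2, h3⟩
    by_contra hc
    exact h.no_right (hmono _ _ _ _ h2 (by omega) h.lt.le (by omega))

theorem arc_two (h : ArcConf N d T π E f) (hp : Lonely N d T) : 2 < d ∧ T 2 d := by
  have hmono := h.mono
  obtain ⟨e, he0, hed, he, he'⟩ := hp.ex
  have he1 : 1 < e := by
    by_contra hc
    exact hp.one (hmono _ _ _ _ he (by omega) (by omega) (by omega))
  refine ⟨by omega, ?_⟩
  by_contra h2
  obtain ⟨c, h3, h4, h5, h6⟩ := h.exists_of_compressed (i := 1) one_pos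
    (hmono _ _ _ _ hp.all (by omega) (by omega) (by omega)) (by
      intro j h3 h4
      have := h.le_of _ _ h3
      have : j < d := by
        by_contra hc
        exact h2 (hmono _ _ _ _ h3 (by omega) (by omega) (by omega))
      exact h4 (hmono _ _ _ _ hp.all (by omega) (by omega) (by omega)))
  rcases h.arc_of_reach hp he1 hed he h3 h4 (by rwa [add_comm]) with h7 | h7
  · exact he' (hmono _ _ _ _ h7 (by omega) (by omega) (by omega))
  · exact h6 (hmono _ _ _ _ h7 (by omega) (by omega) (by omega))

theorem arc_three (h : ArcConf N d T π E f) (hp : Lonely N d T) {x : ℤ} (hx : 2 < x)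
    (hxd : x < d) : T x (d + 1) := by
  have hmono := h.mono
  have h2d := (h.arc_two hp).2
  suffices T 3 (d + 1) from hmono _ _ _ _ this (by omega) (by omega) (by omega)
  by_contra h3
  obtain ⟨c, h4, h5, h6, h7⟩ := h.exists_of_compressed (i := 2) two_pos
    (hmono _ _ _ _ hp.all (by omega) (by omega) (by omega)) (by
      intro j h4 h5
      have := h.le_of _ _ h4
      have : j < d + 1 := by
        by_contra hc
        exact h3 (hmono _ _ _ _ h4 (by omega) (by omega) (by omega))
      exact h5 (hmono _ _ _ _ h2d (by omega) (by omega) (by omega)))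
  rcases h.arc_of_reach hp (x := 3) (by omega) (by omega)
    (hmono _ _ _ _ h2d (by omega) (by omega) (by omega)) h4 h5
    (hmono _ _ _ _ h6 (by omega) (by omega) (by omega)) with h8 | h8
  · exact h3 (hmono _ _ _ _ h8 (by omega) (by omega) (by omega))
  · exact h7 (hmono _ _ _ _ h8 (by omega) (by omega) (by omega))

theorem not_arc_two (h : ArcConf N d T π E f) (hp : Lonely N d T) : ¬ T 2 (d + 1) := by
  obtain ⟨e, he0, hed, he, he'⟩ := hp.ex
  exact fun h2 => by
    have : ¬ 2 ≤ e := fun hc =>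
      he' (h.mono _ _ _ _ h2 (by omega) (by omega) (by omega))
    exact hp.one (h.mono _ _ _ _ he (by omega) (by omega) (by omega))

theorem arc_two' (h : ArcConf N d T π E f) (hp : Lonely N d T) : d + 2 < N ∧ T (d + 2) N := by
  obtain ⟨h1, h2⟩ := h.swap.arc_two (h.lonely_swap hp)
  rw [sub_add_cancel, add_comm 2] at h2
  exact ⟨by omega, h2⟩

theorem arc_three' (h : ArcConf N d T π E f) (hp : Lonely N d T) {x : ℤ} (hx : d + 2 < x)
    (hxN : x < N) : T x (N + 1) := by
  have h1 := h.swap.arc_three (h.lonely_swap hp) (x := x - d) (by omega) (by omega)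
  rwa [sub_add_cancel, show N - d + 1 + d = N + 1 by ring] at h1

theorem not_arc_two' (h : ArcConf N d T π E f) (hp : Lonely N d T) : ¬ T (d + 2) (N + 1) := by
  have h1 := h.swap.not_arc_two (h.lonely_swap hp)
  rwa [show N - d + 1 + d = N + 1 by ring, add_comm 2] at h1

theorem adj_of_three_le (h : ArcConf N d T π E f) (hp : Lonely N d T) {x : ℤ} (hx : 2 < x)
    (hxd : x < d) (y : X) : E (π x) y := by
  have hmono := h.mono
  have hsymm := h.umb.symm
  have hx' := h.arc_three hp hx hxd
  obtain ⟨h2N, h2⟩ := h.arc_two' hp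
  obtain ⟨k, hk0, hkN, rfl⟩ := h.surj y
  have hxd' : E (π x) (π d) :=
    h.of_arc _ _ (hmono _ _ _ _ hx' (by omega) (by omega) (by omega))
  rcases lt_trichotomy k d with hkd | rfl | hkd
  · rcases le_total k x with hkx | hkx
    · exact hsymm _ _ (h.of_arc _ _ (hmono _ _ _ _ hp.all (by omega) (by omega) (by omega)))
    · exact h.of_arc _ _ (hmono _ _ _ _ hp.all (by omega) (by omega) (by omega))
  · exact hxd'
  · rcases lt_trichotomy k (d + 2) with hk | hk | hk
    · exact h.of_arc _ _ (hmono _ _ _ _ hx' (by omega) (by omega) (by omega))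
    · subst hk
      by_contra hc
      refine h.umb.no_square (x := π x) (y := π (d + 1)) (z := π (d + 2)) (w := π 0)
        (h.of_arc _ _ hx') ?_ (h.adj_wrap (by simpa using h2)) ?_ hc ?_
      · exact h.of_arc _ _ (hmono _ _ _ _ hp.all' (by omega) (by omega) (by omega))
      · exact h.of_arc _ _ (hmono _ _ _ _ hp.all (by omega) (by omega) (by omega))
      · intro h1
        refine h.not_adj le_rfl (by have := h.pos; omega) (by omega) (by omega) ?_ ?_ (hsymm _ _ h1)
        · exact fun h3 => h.no_left (hmono _ _ _ _ h3 (by omega) (by omega) (by omega))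
        · simpa using hp.one'
    · rcases h.arc_of_reach hp (by omega) hxd
        (hmono _ _ _ _ hx' (by omega) (by omega) (by omega)) hkd hkN
        (h.arc_three' hp hk hkN) with h1 | h1
      · exact h.of_arc _ _ h1
      · exact hsymm _ _ (h.adj_wrap h1)

theorem isDominoConf (h : ArcConf N d T π E f) (hp : Lonely N d T) :
    IsDominoConf E (π 0) (π d) := by
  have hmono := h.mono
  have hsymm := h.umb.symm
  have hnr := h.no_right
  have hnl := h.no_left
  obtain ⟨h2d, h2⟩ := h.arc_two hp
  obtain ⟨h2N, h2'⟩ := h.arc_two' hp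
  have hn2 := h.not_arc_two hp
  have hn2' := h.not_arc_two' hp
  refine ⟨π 1, π (d + 1), π 2, π (d + 2), ⟨?_, ?_, ?_, ?_, ?_, ?_⟩,
    ⟨?_, ?_, ?_, ?_, ?_, ?_, ?_, ?_⟩, ?_⟩
  · refine h.not_adj le_rfl (by omega) (by omega) (by omega) ?_ (by simpa using hp.one')
    exact fun h3 => hnl (hmono _ _ _ _ h3 (by omega) (by omega) (by omega))
  · refine fun hE => h.not_adj (by omega) (by omega) h.lt (by omega) hp.one ?_ (hsymm _ _ hE)
    exact fun h3 => hnr (hmono _ _ _ _ h3 (by omega) (by omega) (by omega))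
  · refine h.not_adj (by omega) (by omega) (by omega) (by omega) ?_ ?_
    · exact fun h3 => hp.one (hmono _ _ _ _ h3 (by omega) (by omega) (by omega))
    · exact fun h3 => hp.one' (hmono _ _ _ _ h3 (by omega) (by omega) (by omega))
  · refine fun hE => h.not_adj (by omega) (by omega) (by omega) (by omega) hn2 ?_ (hsymm _ _ hE)
    exact fun h3 => hp.one' (hmono _ _ _ _ h3 (by omega) (by omega) (by omega))
  · refine h.not_adj (by omega) (by omega) (by omega) (by omega) ?_ ?_
    · exact fun h3 => hn2 (hmono _ _ _ _ h3 (by omega) (by omega) (by omega))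
    · exact fun h3 => hn2' (hmono _ _ _ _ h3 (by omega) (by omega) (by omega))
  · refine fun hE => h.not_adj (by omega) (by omega) (by omega) (by omega) ?_ ?_ (hsymm _ _ hE)
    · exact fun h3 => hp.one (hmono _ _ _ _ h3 (by omega) (by omega) (by omega))
    · exact fun h3 => hn2' (hmono _ _ _ _ h3 (by omega) (by omega) (by omega))
  · exact h.of_arc _ _ (hmono _ _ _ _ hp.all (by omega) (by omega) (by omega))
  · exact h.of_arc _ _ (hmono _ _ _ _ hp.all (by omega) (by omega) (by omega))
  · exact hsymm _ _ (h.adj_wrap (by simpa using h2'))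
  · exact h.of_arc _ _ (hmono _ _ _ _ hp.all' (by omega) (by omega) (by omega))
  · exact hsymm _ _ (h.of_arc _ _ h2)
  · exact h.of_arc _ _ (hmono _ _ _ _ hp.all' (by omega) (by omega) (by omega))
  · exact h.of_arc _ _ (hmono _ _ _ _ hp.all (by omega) (by omega) (by omega))
  · exact h.of_arc _ _ (hmono _ _ _ _ hp.all' (by omega) (by omega) (by omega))
  · intro x hx0 hxd hx1 hxd1 hx2 hxd2 y
    obtain ⟨k, hk0, hkN, rfl⟩ := h.surj x
    have k0 : k ≠ 0 := fun hk => hx0 (by rw [hk])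
    have kd : k ≠ d := fun hk => hxd (by rw [hk])
    have k1 : k ≠ 1 := fun hk => hx1 (by rw [hk])
    have kd1 : k ≠ d + 1 := fun hk => hxd1 (by rw [hk])
    have k2 : k ≠ 2 := fun hk => hx2 (by rw [hk])
    have kd2 : k ≠ d + 2 := fun hk => hxd2 (by rw [hk])
    rcases lt_or_ge k d with hkd | hkd
    · exact h.adj_of_three_le hp (by omega) hkd y
    · have := h.swap.adj_of_three_le (h.lonely_swap hp) (x := k - d) (by omega) (by omega) y
      simpa using this

theorem no_double' (h : ArcConf N d T π E f) {m l : ℤ} (hm0 : 0 < m) (hmd : m < d)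
    (h0m : T 0 m) (hm : T m d) (hdl : d < l) (hlN : l < N) (hl : T d l) (hl' : T l N)
    (hQ : ¬ T 0 (d - 1)) (hQ' : ¬ T (d + 1) N) : False := by
  refine h.swap.no_double (m := l - d) (l := m + N - d) (by omega) (by omega) (by simpa using hl)
    (by simpa using hl') (by omega) (by omega) ?_ ?_ ?_ ?_
  · rw [show N - d + d = 0 + N by ring, sub_add_cancel, h.shift]; exact h0m
  · rw [sub_add_cancel, add_comm N d, h.shift]; exact hm
  · rw [sub_add_cancel, add_comm]; exact hQ'
  · rw [show N - d + d = 0 + N by ring, show N - 1 + d = d - 1 + N by ring, h.shift]; exact hQ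

theorem isDominoConf_of_not (h : ArcConf N d T π E f) {m l : ℤ} (hm0 : 0 < m) (hmd : m < d)
    (h0m : T 0 m) (hm : T m d) (hdl : d < l) (hlN : l < N) (hl : T d l) (hl' : T l N)
    (hP : ¬ T 1 d) (hQ : ¬ T (d + 1) N) : IsDominoConf E (π 0) (π d) := by
  obtain ⟨c, hc1, hc2, hc3, hc4, hc5⟩ := h.exists_opposite hm0 hmd h0m hm hP
  obtain ⟨e, he1, he2, he3, he4, he5⟩ := h.swap.exists_opposite (m := l - d) (by omega) (by omega)
    (by simpa using hl) (by simpa using hl') (by rwa [add_comm 1, sub_add_cancel])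
  rw [add_comm N d, show e + d = e + d - N + N by ring, h.shift] at he4
  rw [show N + 1 + d = d + 1 + N by ring, show e + d = e + d - N + N by ring, h.shift] at he5
  refine h.isDominoConf ⟨hP, hQ, ?_, ?_, ⟨e + d - N, by omega, by omega, he4, he5⟩,
    ⟨c, hc1, hc2, hc4, hc5⟩⟩
  · by_contra hc
    exact h.no_double' hm0 hmd h0m hm hdl hlN hl hl' hc hQ
  · by_contra hc
    exact h.no_double hm0 hmd h0m hm hdl hlN hl hl' hP hc

theorem not_or_not (h : ArcConf N d T π E f)
    (hnot : ¬ ∀ i, 0 < i → i < d → T 0 i ∧ T i d) : ¬ T 1 d ∨ ¬ T 0 (d - 1) := by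
  by_contra! hc
  exact hnot fun i h1 h2 => ⟨h.mono _ _ _ _ hc.2 (by omega) (by omega) (by omega),
    h.mono _ _ _ _ hc.1 (by omega) (by omega) (by omega)⟩

theorem exists_common' (h : ArcConf N d T π E f) {m : ℤ} (hm0 : 0 < m) (hmd : m < d)
    (h0m : T 0 m) (hm : T m d) (hnot : ¬ ∀ i, 0 < i → i < d → T 0 i ∧ T i d) :
    ∃ l, d < l ∧ l < N ∧ T d l ∧ T l N := by
  rcases h.not_or_not hnot with h1 | h1
  · obtain ⟨c, h2, h3, h4, h5, -⟩ := h.exists_opposite hm0 hmd h0m hm h1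
    exact ⟨c, h2, h3, h4, h5⟩
  · obtain ⟨c, h2, h3, h4, h5, -⟩ := h.reflect.exists_opposite (m := d - m) (by omega) (by omega)
      (by simpa using hm) (by simpa using h0m) (by simpa using h1)
    refine ⟨d - c + N, by omega, by omega, ?_, ?_⟩
    · rwa [← h.shift, show d - N + N = d by ring] at h5
    · rw [← h.shift, sub_self, zero_add] at h4
      exact h4

end ArcConf

theorem IsDominoConf.swap {X : Type*} {E : X → X → Prop} {a b : X} (hE : ∀ x y, E x y → E y x)
    (h : IsDominoConf E a b) : IsDominoConf E b a := by
  obtain ⟨p, q, c, e, ⟨h1, h2, h3, h4, h5, h6⟩, ⟨g1, g2, g3, g4, g5, g6, g7, g8⟩, h7⟩ := h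
  refine ⟨q, p, e, c, ⟨h2, h1, ?_, ?_, ?_, ?_⟩, ⟨g4, g6, g5, g1, g3, g2, g8, g7⟩, ?_⟩
  · exact fun h => h3 (hE _ _ h)
  · exact fun h => h6 (hE _ _ h)
  · exact fun h => h5 (hE _ _ h)
  · exact fun h => h4 (hE _ _ h)
  · intro x k1 k2 k3 k4 k5 k6
    exact h7 x k2 k1 k4 k3 k6 k5

namespace ArcConf

variable {X : Type*} {N d : ℤ} {T : ℤ → ℤ → Prop} {π : ℤ → X} {E : X → X → Prop} {f : X → ℤ}

theorem trichotomy_of_common (h : ArcConf N d T π E f) {m : ℤ} (hm0 : 0 < m) (hmd : m < d)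
    (h0m : T 0 m) (hm : T m d) :
    (∀ i, 0 < i → i < d → T 0 i ∧ T i d) ∨ (∀ i, d < i → i < N → T d i ∧ T i N) ∨
      IsDominoConf E (π 0) (π d) := by
  by_cases h1 : ∀ i, 0 < i → i < d → T 0 i ∧ T i d
  · exact .inl h1
  by_cases h2 : ∀ i, d < i → i < N → T d i ∧ T i N
  · exact .inr (.inl h2)
  obtain ⟨l, hdl, hlN, hl, hl'⟩ := h.exists_common' hm0 hmd h0m hm h1
  have h3 := h.swap.not_or_not (by
    contrapose! h2
    intro i h3 h4
    simpa using h2 (i - d) (by omega) (by omega))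
  rw [zero_add, add_comm 1, show N - d - 1 + d = N - 1 by ring, sub_add_cancel] at h3
  refine .inr (.inr ?_)
  rcases h.not_or_not h1 with h1 | h1 <;> rcases h3 with h3 | h3
  · exact h.isDominoConf_of_not hm0 hmd h0m hm hdl hlN hl hl' h1 h3
  · exact (h.no_double hm0 hmd h0m hm hdl hlN hl hl' h1 h3).elim
  · exact (h.no_double' hm0 hmd h0m hm hdl hlN hl hl' h1 h3).elim
  · have := h.reflect.isDominoConf_of_not (m := d - m) (l := d - l + N) (by omega) (by omega)
      (by simpa using hm) (by simpa using h0m) (by omega) (by omega) ?_ ?_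
      (by simpa using h1) ?_
    · simpa using this.swap h.umb.symm
    · rwa [← h.shift, show d - (d - l + N) + N = l by ring, sub_self, zero_add]
    · rwa [← h.shift, show d - (d - l + N) + N = l by ring, sub_add_cancel]
    · rw [← h.shift, show d - N + N = d by ring, show d - (d + 1) + N = N - 1 by ring]; exact h3

theorem trichotomy_of_noGap (h : ArcConf N d T π E f) (hgap : ∀ i, 0 ≤ i → i < d → T i (i + 1)) :
    (∀ i, 0 < i → i < d → T 0 i ∧ T i d) ∨ (∀ i, d < i → i < N → T d i ∧ T i N) ∨
      IsDominoConf E (π 0) (π d) := by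
  obtain ⟨m, h1, h2, h3, h4⟩ := h.exists_common hgap
  exact h.trichotomy_of_common h1 h2 h3 h4

theorem trichotomy (h : ArcConf N d T π E f) :
    (∀ i, 0 < i → i < d → T 0 i ∧ T i d) ∨ (∀ i, d < i → i < N → T d i ∧ T i N) ∨
      IsDominoConf E (π 0) (π d) := by
  by_cases hgap : ∀ i, 0 ≤ i → i < d → T i (i + 1)
  · exact h.trichotomy_of_noGap hgap
  push Not at hgap
  obtain ⟨j, hj0, hjd, hj⟩ := hgap
  have hlt := h.lt
  rcases h.swap.trichotomy_of_noGap (fun i hi0 hi => by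
    rw [add_right_comm]
    exact (h.conn j (i + d) (by omega) (by omega)).resolve_left hj) with h1 | h1 | h1
  · right; left
    intro i h2 h3
    simpa using h1 (i - d) (by omega) (by omega)
  · left
    intro i h2 h3
    have := h1 (i + N - d) (by omega) (by omega)
    rw [show N - d + d = 0 + N by ring, show i + N - d + d = i + N by ring, h.shift,
      add_comm N d, h.shift] at this
    exact this
  · right; right
    have := h1.swap h.umb.symm
    rw [← h.per 0]
    simpa using this

end ArcConf

theorem IsRoundRep.le_add {n : ℕ} {r : ZMod n → ℕ} (hr : IsRoundRep n r) (i : ZMod n) (t : ℕ) :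
    r i ≤ r (i + t) + t := by
  induction t with
  | zero => simp
  | succ t ih =>
    have := hr.2 (i + t)
    rw [show i + ((t + 1 : ℕ) : ZMod n) = i + t + 1 by push_cast; ring]
    omega

theorem arrow_iff_of_straight {m : ℕ} [NeZero m] {s : ZMod m → ℕ} (hs : IsRoundRep m s)
    {z : ZMod m} (hz : s z = 0) (i j : ZMod m) :
    Arrow s i j ↔ (i - (z + 1)).val < (j - (z + 1)).val ∧
      (j - (z + 1)).val ≤ (i - (z + 1)).val + s i := by
  have hlt : ∀ x : ZMod m, (x - (z + 1)).val < m := fun x => ZMod.val_lt _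
  have heq : ∀ x : ZMod m, x = z + 1 + ((x - (z + 1)).val : ℕ) := fun x => by simp
  constructor
  · rintro ⟨k, hk1, hk2, rfl⟩
    have h1 := hlt i
    have h2 := hs.le_add i (m - 1 - (i - (z + 1)).val)
    have h3 : i + ((m - 1 - (i - (z + 1)).val : ℕ) : ZMod m) = z := by
      conv_lhs => enter [1]; rw [heq i]
      rw [add_assoc, ← Nat.cast_add, show (i - (z + 1)).val + (m - 1 - (i - (z + 1)).val) = m - 1 by
        omega, Nat.cast_sub (by omega)]
      simp
    rw [h3, hz] at h2
    have h4 : (i + k - (z + 1)).val = (i - (z + 1)).val + k := by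
      rw [show i + k - (z + 1) = (((i - (z + 1)).val + k : ℕ) : ZMod m) by
        push_cast; rw [ZMod.natCast_zmod_val]; ring]
      exact ZMod.val_cast_of_lt (by omega)
    omega
  · rintro ⟨h1, h2⟩
    refine ⟨(j - (z + 1)).val - (i - (z + 1)).val, by omega, by omega, ?_⟩
    rw [Nat.cast_sub h1.le]
    simp

theorem mono_of_straight {m : ℕ} [NeZero m] {s : ZMod m → ℕ} (hs : IsRoundRep m s)
    {z : ZMod m} {i j : ZMod m} (hij : (i - (z + 1)).val ≤ (j - (z + 1)).val) :
    (i - (z + 1)).val + s i ≤ (j - (z + 1)).val + s j := by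
  have h2 := hs.le_add i ((j - (z + 1)).val - (i - (z + 1)).val)
  rw [Nat.cast_sub hij] at h2
  simp only [ZMod.natCast_val, ZMod.cast_id', id_eq] at h2
  rw [show i + (j - (z + 1) - (i - (z + 1))) = j by ring] at h2
  omega

theorem roundGraph_adj_iff {n : ℕ} (r : ZMod n → ℕ) (i j : ZMod n) :
    (roundGraph r).Adj i j ↔ i ≠ j ∧ (Arrow r i j ∨ Arrow r j i) := by
  simp [roundGraph]

/-- Proper interval graphs have the umbrella ordering. -/
theorem IsPIG.exists_umbrella {V : Type*} {G : SimpleGraph V} (hG : IsPIG G) :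
    ∃ f : V → ℤ, Umbrella (fun u v => u = v ∨ G.Adj u v) f := by
  obtain ⟨m, hm, s, γ, ⟨hs, -, -, hadj⟩, z, hz⟩ := hG
  have : NeZero m := ⟨by omega⟩
  have key : ∀ u v, (u = v ∨ G.Adj u v) ↔
      ((γ u - (z + 1)).val ≤ (γ v - (z + 1)).val ∧
        (γ v - (z + 1)).val ≤ (γ u - (z + 1)).val + s (γ u)) ∨
      ((γ v - (z + 1)).val ≤ (γ u - (z + 1)).val ∧
        (γ u - (z + 1)).val ≤ (γ v - (z + 1)).val + s (γ v)) := by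
    intro u v
    by_cases huv : u = v
    · simp [huv]
    rw [hadj u v huv, roundGraph_adj_iff, arrow_iff_of_straight hs hz,
      arrow_iff_of_straight hs hz]
    by_cases hγ : γ u = γ v
    · simp [hγ]
    · have : (γ u - (z + 1)).val ≠ (γ v - (z + 1)).val := fun h =>
        hγ (sub_left_injective (ZMod.val_injective m h))
      simp only [huv, hγ, false_or, ne_eq, not_false_eq_true, true_and]
      omega
  refine ⟨fun v => ((γ v - (z + 1)).val : ℤ), fun v => .inl rfl, fun u v h => ?_, ?_, ?_⟩
  · exact h.imp Eq.symm SimpleGraph.Adj.symm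
  all_goals
    intro u v w h1 h2 h3
    rw [key] at h3 ⊢
    have h1 : (γ u - (z + 1)).val ≤ (γ v - (z + 1)).val := by exact_mod_cast h1
    have h2 : (γ v - (z + 1)).val ≤ (γ w - (z + 1)).val := by exact_mod_cast h2
    have h4 := mono_of_straight hs h1
    have h5 := mono_of_straight hs h2
    omega

/-- The arcs of a round representation, unrolled along the integers from the point `a`. -/
def unrolled {n : ℕ} (r : ZMod n → ℕ) (a : ZMod n) (i j : ℤ) : Prop :=
  i ≤ j ∧ j ≤ i + r (a + (i : ZMod n))

theorem intCast_inj_of_lt {n : ℕ} {i j : ℤ} (hij : i ≤ j) (hj : j < i + n)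
    (h : (i : ZMod n) = j) : i = j := by
  rw [ZMod.intCast_eq_intCast_iff_dvd_sub] at h
  have := Int.eq_zero_of_dvd_of_nonneg_of_lt (by omega) (by omega) h
  omega

theorem arrow_of_unrolled {n : ℕ} {r : ZMod n → ℕ} {a : ZMod n} {i j : ℤ} (hij : i < j)
    (h : unrolled r a i j) : Arrow r (a + i) (a + j) := by
  refine ⟨(j - i).toNat, by omega, by have := h.2; omega, ?_⟩
  have : (((j - i).toNat : ℕ) : ZMod n) = ((j - i : ℤ) : ZMod n) := by
    rw [← Int.cast_natCast, Int.toNat_of_nonneg (by omega)]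
  rw [this]
  push_cast
  ring

theorem unrolled_of_arrow {n : ℕ} {r : ZMod n → ℕ} (hr : IsRoundRep n r) {a : ZMod n} {i j : ℤ}
    (hij : i < j) (hj : j < i + n) (h : Arrow r (a + i) (a + j)) : unrolled r a i j := by
  obtain ⟨k, hk1, hk2, hk⟩ := h
  have h1 := hr.1 (a + i)
  have h2 : (j : ZMod n) = ((i + k : ℤ) : ZMod n) := by
    push_cast
    rw [add_assoc] at hk
    exact add_left_cancel hk
  rcases le_total j (i + k) with h3 | h3
  · have := intCast_inj_of_lt h3 (by omega) h2
    exact ⟨by omega, by omega⟩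
  · have := intCast_inj_of_lt h3 (by omega) h2.symm
    exact ⟨by omega, by omega⟩

theorem unrolled_shift {n : ℕ} (r : ZMod n → ℕ) (a : ZMod n) (i j : ℤ) :
    unrolled r a (i + n) (j + n) ↔ unrolled r a i j := by
  simp only [unrolled]
  push_cast
  rw [ZMod.natCast_self, add_zero]
  omega

theorem unrolled_mono {n : ℕ} {r : ZMod n → ℕ} (hr : IsRoundRep n r) {a : ZMod n} {i j k l : ℤ}
    (h : unrolled r a i l) (hij : i ≤ j) (hjk : j ≤ k) (hkl : k ≤ l) : unrolled r a j k := by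
  have h1 := hr.le_add (a + i) (j - i).toNat
  have h2 : a + (i : ZMod n) + (((j - i).toNat : ℕ) : ZMod n) = a + j := by
    rw [← Int.cast_natCast, Int.toNat_of_nonneg (by omega)]
    push_cast
    ring
  rw [h2] at h1
  have := h.2
  exact ⟨hjk, by omega⟩

theorem adj_iff_unrolled {n : ℕ} {r : ZMod n → ℕ} (hr : IsRoundRep n r) {a : ZMod n} {i j : ℤ}
    (hij : i < j) (hj : j < i + n) :
    (roundGraph r).Adj (a + i) (a + j) ↔ unrolled r a i j ∨ unrolled r a j (i + n) := by
  have h0 : a + ((i + n : ℤ) : ZMod n) = a + i := by simp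
  rw [roundGraph_adj_iff]
  constructor
  · rintro ⟨-, h | h⟩
    · exact .inl (unrolled_of_arrow hr hij hj h)
    · exact .inr (unrolled_of_arrow hr (by omega) (by omega) (by rwa [h0]))
  · intro h
    refine ⟨fun he => hij.ne (intCast_inj_of_lt hij.le hj (add_left_cancel he)), ?_⟩
    rcases h with h | h
    · exact .inl (arrow_of_unrolled hij h)
    · have := arrow_of_unrolled (by omega) h
      rw [h0] at this
      exact .inr this

theorem Compressed.exists_unrolled {n : ℕ} [NeZero n] {r : ZMod n → ℕ} (hr : IsRoundRep n r)
    (hc : Compressed r) {a : ZMod n} (hn : 1 < n) {i : ℤ} (hi : unrolled r a i (i + 1)) :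
    (∃ j, unrolled r a (i + 1) j ∧ ¬ unrolled r a i j) ∨
      ∃ j, j < i ∧ unrolled r a j i ∧ ¬ unrolled r a j (i + 1) := by
  by_contra! hno
  obtain ⟨h1, h2⟩ := hno
  have hri := hi.2
  have hle := hr.2 (a + i)
  have hcast : a + ((i + 1 : ℤ) : ZMod n) = a + i + 1 := by push_cast; ring
  have hreq : r (a + i) = r (a + i + 1) + 1 := by
    have := (h1 (i + 1 + r (a + i + 1)) ⟨by omega, by rw [hcast]⟩).2
    omega
  have hne : a + (i : ZMod n) ≠ a + i + 1 := by
    have : Fact (1 < n) := ⟨hn⟩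
    simp
  have harr : Arrow r (a + i) (a + i + 1) := ⟨1, le_rfl, by omega, by simp⟩
  apply hne
  refine hc _ _ ?_ ?_
  · have hset : {j | Arrow r j (a + i + 1)} = insert (a + (i : ZMod n)) {j | Arrow r j (a + i)} := by
      ext x
      simp only [Set.mem_ofPred_eq, Set.mem_insert_iff]
      constructor
      · rintro ⟨k, hk1, hk2, hk⟩
        rcases eq_or_lt_of_le hk1 with rfl | hk1
        · left
          simpa using hk.symm
        · refine .inr ⟨k - 1, by omega, by omega, ?_⟩
          rw [Nat.cast_sub hk1.le, Nat.cast_one, add_sub, ← hk]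
          simp
      · rintro (rfl | ⟨k, hk1, hk2, hk⟩)
        · exact harr
        · have hx : x = a + ((i - k : ℤ) : ZMod n) := by
            push_cast
            rw [← add_sub_assoc, hk]
            simp
          have h3 := h2 (i - k) (by omega) ⟨by omega, by rw [← hx]; omega⟩
          rw [hx, ← hcast]
          exact arrow_of_unrolled (by omega) h3
    have hnot : a + (i : ZMod n) ∉ {j | Arrow r j (a + i)} := by
      rintro ⟨k, hk1, hk2, hk⟩
      have h3 := hr.1 (a + i)
      have h4 : ((k : ℕ) : ZMod n) = 0 := by simpa using hk.symm
      rw [ZMod.natCast_eq_zero_iff] at h4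
      exact absurd (Nat.le_of_dvd (by omega) h4) (by omega)
    simp only [Fl]
    rw [hset, Set.ncard_insert_of_notMem hnot (Set.toFinite _)]
    push_cast
    ring
  · simp only [Fr]
    rw [hreq]
    push_cast
    ring

theorem unrolled_conn {n : ℕ} {r : ZMod n → ℕ} (hr : IsRoundRep n r)
    (hconn : (roundGraph r).Connected) (a : ZMod n) {i j : ℤ} (hij : i < j) (hj : j < i + n) :
    unrolled r a i (i + 1) ∨ unrolled r a j (j + 1) := by
  by_contra! hno
  obtain ⟨h1, h2⟩ := hno
  have hstep : ∀ x y, (roundGraph r).Adj x y → (∃ k : ℤ, i < k ∧ k ≤ j ∧ x = a + k) →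
      ∃ k : ℤ, i < k ∧ k ≤ j ∧ y = a + k := by
    rintro x y hxy ⟨k, hk1, hk2, rfl⟩
    by_contra hy
    have hn : NeZero n := ⟨by omega⟩
    have hl : y = a + ((j + 1 + (y - a - (j + 1 : ℤ)).val : ℤ) : ZMod n) := by
      push_cast
      simp
    have hlt := ZMod.val_lt (y - a - ((j + 1 : ℤ) : ZMod n))
    generalize (y - a - ((j + 1 : ℤ) : ZMod n)).val = t at hl hlt
    generalize hL : j + 1 + (t : ℤ) = l at hl
    subst hl
    by_cases hli : l ≤ i + n
    · rcases (adj_iff_unrolled hr (by omega) (by omega)).1 hxy with h | h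
      · exact h2 (unrolled_mono hr h (by omega) (by omega) (by omega))
      · rw [← unrolled_shift] at h1
        exact h1 (unrolled_mono hr h (by omega) (by omega) (by omega))
    · exact hy ⟨l - n, by omega, by omega, by simp⟩
  have hreach : ∀ x y, (roundGraph r).Walk x y → (∃ k : ℤ, i < k ∧ k ≤ j ∧ x = a + k) →
      ∃ k : ℤ, i < k ∧ k ≤ j ∧ y = a + k := by
    intro x y p
    induction p with
    | nil => exact id
    | cons hadj _ ih => exact fun hx => ih (hstep _ _ hadj hx)
  obtain ⟨p⟩ := hconn.preconnected (a + (j : ZMod n)) (a + (i : ZMod n))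
  obtain ⟨k, hk1, hk2, hk⟩ := hreach _ _ p ⟨j, hij, le_rfl, rfl⟩
  have := intCast_inj_of_lt hk1.le (by omega) (add_left_cancel hk)
  omega

theorem connectable_of_unrolled {n : ℕ} [NeZero n] {r : ZMod n → ℕ} (hr : IsRoundRep n r)
    {a : ZMod n} {d : ℤ} (hd : 0 < d) (hdn : d < n) (hno : ¬ unrolled r a 0 d)
    (hall : ∀ i, 0 < i → i < d → unrolled r a 0 i ∧ unrolled r a i d) :
    Connectable r a (a + d) := by
  have hra : (r a : ℤ) = d - 1 := by
    have h1 : ¬ d ≤ r a := fun h => hno ⟨hd.le, by simpa using h⟩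
    rcases eq_or_lt_of_le (show 1 ≤ d by omega) with h2 | h2
    · omega
    · have := (hall (d - 1) (by omega) (by omega)).1.2
      simp only [Int.cast_zero, add_zero, zero_add] at this
      omega
  refine ⟨?_, ?_⟩
  · simp only [Ur, Fr]
    rw [← Int.cast_natCast (r a), hra]
    push_cast
    ring
  · have hset : {j | Arrow r j (a + (d : ZMod n))} =
        ((fun i : ℤ => a + (i : ZMod n)) '' (Finset.Ioo 0 d : Finset ℤ)) := by
      ext x
      simp only [Set.mem_ofPred_eq, Set.mem_image, Finset.coe_Ioo, Set.mem_Ioo]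
      constructor
      · rintro ⟨k, hk1, hk2, hk⟩
        have hx : x = a + ((d - k : ℤ) : ZMod n) := by
          push_cast
          rw [← add_sub_assoc, hk]
          simp
        refine ⟨d - k, ⟨?_, by omega⟩, hx.symm⟩
        by_contra hc
        refine hno (unrolled_mono hr (i := d - k) (l := d) ⟨by omega, ?_⟩ (by omega) hd.le le_rfl)
        rw [← hx]
        omega
      · rintro ⟨i, ⟨hi0, hid⟩, rfl⟩
        exact arrow_of_unrolled hid (hall i hi0 hid).2
    have hinj : Set.InjOn (fun i : ℤ => a + (i : ZMod n)) (Finset.Ioo 0 d : Finset ℤ) := by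
      intro i hi j hj hij
      simp only [Finset.coe_Ioo, Set.mem_Ioo] at hi hj
      have hij := add_left_cancel hij
      rcases le_total i j with h | h
      · exact intCast_inj_of_lt h (by omega) hij
      · exact (intCast_inj_of_lt h (by omega) hij.symm).symm
    simp only [Ul, Fl]
    rw [hset, hinj.ncard_image, Set.ncard_coe_finset, Int.card_Ioo,
      ← Int.cast_natCast, Int.toNat_of_nonneg (by omega)]
    push_cast
    ring

theorem nonempty_induce_range_iso {X ι : Type*} {Γ : SimpleGraph X} {H : SimpleGraph ι}
    {φ : ι → X} (hφ : Function.Injective φ) (h : ∀ i j, Γ.Adj (φ i) (φ j) ↔ H.Adj i j) {S : Set X}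
    (hS : S = Set.range φ) : Nonempty (Γ.induce S ≃g H) := by
  subst hS
  exact ⟨(RelIso.mk (Equiv.ofInjective φ hφ) (fun {i j} => h i j) :
    H ≃g Γ.induce (Set.range φ)).symm⟩

theorem nonempty_iso_pGraph_compl {X : Type*} {Γ : SimpleGraph X} {p q a e c : X}
    (h1 : p ≠ q ∧ ¬ Γ.Adj p q) (h2 : q ≠ a ∧ ¬ Γ.Adj q a) (h3 : e ≠ c ∧ ¬ Γ.Adj e c)
    (h4 : p ≠ e ∧ ¬ Γ.Adj p e) (h5 : q ≠ c ∧ ¬ Γ.Adj q c)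
    (g1 : Γ.Adj p a) (g2 : Γ.Adj p c) (g3 : Γ.Adj q e) (g4 : Γ.Adj a e) (g5 : Γ.Adj a c) :
    Nonempty (Γ.induce {a, p, q, c, e} ≃g pGraphᶜ) := by
  refine nonempty_induce_range_iso (φ := ![p, q, a, e, c]) ?_ ?_ ?_
  · have := g1.ne
    have := g2.ne
    have := g3.ne
    have := g4.ne
    have := g5.ne
    intro i j hij
    fin_cases i <;> fin_cases j <;> simp_all
  · intro i j
    have := g1.symm
    have := g2.symm
    have := g3.symm
    have := g4.symm
    have := g5.symm
    fin_cases i <;> fin_cases j <;> simp_all [pGraph, Γ.adj_comm]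
  · ext x
    simp
    tauto

theorem nonempty_iso_dominoGraph_compl {X : Type*} {Γ : SimpleGraph X} {a b p q c e : X}
    (h0 : a ≠ b ∧ ¬ Γ.Adj a b)
    (h1 : p ≠ q ∧ ¬ Γ.Adj p q) (h2 : q ≠ a ∧ ¬ Γ.Adj q a) (h3 : e ≠ c ∧ ¬ Γ.Adj e c)
    (h4 : p ≠ e ∧ ¬ Γ.Adj p e) (h5 : q ≠ c ∧ ¬ Γ.Adj q c) (h6 : p ≠ b ∧ ¬ Γ.Adj p b)
    (g1 : Γ.Adj p a) (g2 : Γ.Adj p c) (g3 : Γ.Adj q e) (g4 : Γ.Adj a e) (g5 : Γ.Adj a c)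
    (g6 : Γ.Adj b q) (g7 : Γ.Adj b c) (g8 : Γ.Adj b e) :
    Nonempty (Γ.induce {a, b, p, q, c, e} ≃g dominoGraphᶜ) := by
  refine nonempty_induce_range_iso (φ := ![c, q, a, e, p, b]) ?_ ?_ ?_
  · have := g1.ne
    have := g2.ne
    have := g3.ne
    have := g4.ne
    have := g5.ne
    have := g6.ne
    have := g7.ne
    have := g8.ne
    intro i j hij
    fin_cases i <;> fin_cases j <;> simp_all
  · intro i j
    have := g1.symm
    have := g2.symm
    have := g3.symm
    have := g4.symm
    have := g5.symm
    have := g6.symm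
    have := g7.symm
    have := g8.symm
    fin_cases i <;> fin_cases j <;> simp_all [dominoGraph, Γ.adj_comm]
  · ext x
    simp
    tauto

/-- Adjacency or equality in the round graph after adding the edge `a b`. -/
def nearAdd {n : ℕ} (r : ZMod n → ℕ) (a b x y : ZMod n) : Prop :=
  x = y ∨ (roundGraph r).Adj x y ∨ (x = a ∧ y = b) ∨ (x = b ∧ y = a)

theorem almostConnectable_of_domino {V : Type*} {n : ℕ} {r : ZMod n → ℕ} {β : V → ZMod n}
    {a b : ZMod n} (hab : a ≠ b) (hnadj : ¬ (roundGraph r).Adj a b)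
    (hva : ∃ v : V, β ⁻¹' {a} = {v}) (hwb : ∃ w : V, β ⁻¹' {b} = {w})
    (hdom : IsDominoConf (nearAdd r a b) a b) : AlmostConnectable r β a b := by
  obtain ⟨p, q, c, e, ⟨h1, h2, h3, h4, h5, h6⟩, ⟨g1, g2, g3, g4, g5, g6, g7, g8⟩, huniv⟩ := hdom
  have hcomm := fun x y => (roundGraph r).adj_comm x y
  simp only [nearAdd, not_or] at h1 h2 h3 h4 h5 h6
  have ap : a ≠ p := by grind
  have bq : b ≠ q := by grind
  have ac : a ≠ c := by rintro rfl; simp only [nearAdd] at g3; grind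
  have ae : a ≠ e := by rintro rfl; simp only [nearAdd] at g2; grind
  have bc : b ≠ c := by rintro rfl; simp only [nearAdd] at g6; grind
  have be : b ≠ e := by rintro rfl; simp only [nearAdd] at g5; grind
  have pc : p ≠ c := by rintro rfl; simp only [nearAdd] at g5; grind
  have qe : q ≠ e := by rintro rfl; simp only [nearAdd] at g3; grind
  have k1 : (roundGraph r).Adj a p := by simp only [nearAdd] at g1; grind
  have k2 : (roundGraph r).Adj a c := by simp only [nearAdd] at g2; grind
  have k3 : (roundGraph r).Adj a e := by simp only [nearAdd] at g3; grind
  have k4 : (roundGraph r).Adj b q := by simp only [nearAdd] at g4; grind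
  have k5 : (roundGraph r).Adj b c := by simp only [nearAdd] at g5; grind
  have k6 : (roundGraph r).Adj b e := by simp only [nearAdd] at g6; grind
  have k7 : (roundGraph r).Adj p c := by simp only [nearAdd] at g7; grind
  have k8 : (roundGraph r).Adj q e := by simp only [nearAdd] at g8; grind
  have l1 : q ≠ a ∧ ¬ (roundGraph r).Adj q a := ⟨by grind, by grind⟩
  have l2 : p ≠ b ∧ ¬ (roundGraph r).Adj p b := ⟨by grind, by grind⟩
  have l3 : p ≠ q ∧ ¬ (roundGraph r).Adj p q := ⟨by grind, by grind⟩
  have l4 : q ≠ c ∧ ¬ (roundGraph r).Adj q c := ⟨by grind, by grind⟩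
  have l5 : e ≠ c ∧ ¬ (roundGraph r).Adj e c := ⟨by grind, by grind⟩
  have l6 : p ≠ e ∧ ¬ (roundGraph r).Adj p e := ⟨by grind, by grind⟩
  clear h1 h2 h3 h4 h5 h6 g1 g2 g3 g4 g5 g6 g7 g8
  have hD1 : ({a, p, q, c, e} : Set (ZMod n)) ∪ {b} = {a, b, p, q, c, e} := by
    ext x; simp; tauto
  have hD2 : (({a, p, q, c, e} : Set (ZMod n)) ∪ {b}) \ {a} = {b, q, p, e, c} := by
    ext x
    simp only [Set.mem_sdiff, Set.mem_union, Set.mem_insert_iff, Set.mem_singleton_iff]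
    grind
  refine ⟨hva, hwb, hab, SimpleGraph.connectedComponentMk _ ⟨a, hab⟩, {a, p, q, c, e}, rfl, ?_,
    nonempty_iso_pGraph_compl l3 l1 l5 l6 l4 k1.symm k7 k8 k3 k2, ?_, ?_⟩
  · have hco : ∀ x y : {x : ZMod n | x ≠ b}, x.1 ≠ y.1 → ¬ (roundGraph r).Adj x.1 y.1 →
        (((roundGraph r).induce {x : ZMod n | x ≠ b})ᶜ).Adj x y := by
      intro x y hxy hadj
      rw [SimpleGraph.compl_adj]
      exact ⟨fun h => hxy (congrArg _ h), hadj⟩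
    have hclosed : ∀ x y : {x : ZMod n | x ≠ b},
        (((roundGraph r).induce {x : ZMod n | x ≠ b})ᶜ).Walk x y →
        x.1 ∈ ({a, p, q, c, e} : Set (ZMod n)) → y.1 ∈ ({a, p, q, c, e} : Set (ZMod n)) := by
      intro x y w
      induction w with
      | nil => exact id
      | @cons x y z hadj _ ih =>
        refine fun hx => ih ?_
        rw [SimpleGraph.compl_adj] at hadj
        have h1 : ¬ (roundGraph r).Adj x.1 y.1 := hadj.2
        have h2 : x.1 ≠ y.1 := fun h => hadj.1 (Subtype.ext h)
        have h3 : y.1 ≠ b := y.2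
        by_contra hy
        simp only [Set.mem_insert_iff, Set.mem_singleton_iff, not_or] at hy
        rcases huniv y.1 hy.1 h3 hy.2.1 hy.2.2.1 hy.2.2.2.1 hy.2.2.2.2 x.1 with h | h | h | h
        · exact h2 h.symm
        · exact h1 h.symm
        · exact hy.1 h.1
        · exact h3 h.1
    have raq : (((roundGraph r).induce {x : ZMod n | x ≠ b})ᶜ).Reachable ⟨q, bq.symm⟩ ⟨a, hab⟩ :=
      (hco _ _ l1.1 l1.2).reachable
    have rap : (((roundGraph r).induce {x : ZMod n | x ≠ b})ᶜ).Reachable ⟨p, l2.1⟩ ⟨a, hab⟩ :=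
      (hco ⟨p, l2.1⟩ ⟨q, bq.symm⟩ l3.1 l3.2).reachable.trans raq
    have rac : (((roundGraph r).induce {x : ZMod n | x ≠ b})ᶜ).Reachable ⟨c, bc.symm⟩ ⟨a, hab⟩ :=
      (hco ⟨q, bq.symm⟩ ⟨c, bc.symm⟩ l4.1 l4.2).reachable.symm.trans raq
    have rae : (((roundGraph r).induce {x : ZMod n | x ≠ b})ᶜ).Reachable ⟨e, be.symm⟩ ⟨a, hab⟩ :=
      (hco ⟨p, l2.1⟩ ⟨e, be.symm⟩ l6.1 l6.2).reachable.symm.trans rap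
    ext x
    simp only [Set.mem_image, SimpleGraph.ConnectedComponent.mem_supp_iff,
      SimpleGraph.ConnectedComponent.eq]
    constructor
    · simp only [Set.mem_insert_iff, Set.mem_singleton_iff]
      rintro (rfl | rfl | rfl | rfl | rfl)
      · exact ⟨_, SimpleGraph.Reachable.refl _, rfl⟩
      · exact ⟨_, rap, rfl⟩
      · exact ⟨_, raq, rfl⟩
      · exact ⟨_, rac, rfl⟩
      · exact ⟨_, rae, rfl⟩
    · rintro ⟨y, ⟨w⟩, rfl⟩
      exact hclosed _ _ w.reverse (by simp)
  · rw [hD1]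
    exact nonempty_iso_dominoGraph_compl ⟨hab, hnadj⟩ l3 l1 l5 l6 l4 l2 k1.symm k7 k8 k3 k2 k4 k5 k6
  · rw [hD2]
    exact nonempty_iso_pGraph_compl ⟨l3.1.symm, fun h => l3.2 h.symm⟩ l2
      ⟨l5.1.symm, fun h => l5.2 h.symm⟩ l4 l6 k4.symm k8 k7 k5 k6

theorem arcConf_unrolled {n : ℕ} {r : ZMod n → ℕ} (hr : IsRoundRep n r) (hc : Compressed r)
    (hconn : (roundGraph r).Connected) {a : ZMod n} {d : ℤ} (hd : 0 < d) (hdn : d < n)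
    (hnadj : ¬ (roundGraph r).Adj a (a + d)) {f : ZMod n → ℤ}
    (hf : Umbrella (nearAdd r a (a + d)) f) :
    ArcConf n d (unrolled r a) (fun i => a + (i : ZMod n)) (nearAdd r a (a + d)) f where
  umb := hf
  pos := hd
  lt := hdn
  surj x := by
    have : NeZero n := ⟨by omega⟩
    exact ⟨(x - a).val, by omega, by exact_mod_cast ZMod.val_lt _, by simp⟩
  per i := by simp
  inj i j hij hj h := intCast_inj_of_lt hij hj (add_left_cancel h)
  le_of i j h := h.1
  mono i j k l h := unrolled_mono hr h
  shift := unrolled_shift r a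
  no_left h := hnadj (by
    simpa using (adj_iff_unrolled hr (a := a) hd (by omega)).2 (.inl h))
  no_right h := hnadj (by
    simpa using (adj_iff_unrolled hr (a := a) hd (by omega)).2 (.inr (by simpa using h)))
  compressed i h := by
    have : NeZero n := ⟨by omega⟩
    exact hc.exists_unrolled hr (by omega) h
  conn i j := unrolled_conn hr hconn a
  edge := .inr (.inr (.inl (by simp)))
  of_arc i j h := by
    rcases eq_or_lt_of_le h.1 with h1 | h1
    · exact .inl (by rw [h1])
    · refine .inr (.inl ((adj_iff_unrolled hr h1 ?_).2 (.inl h)))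
      have := h.2
      have := hr.1 (a + i)
      omega
  elim i j hij hj h := by
    rw [← or_assoc, ← adj_iff_unrolled hr hij hj]
    rcases h with h | h | h | h
    · exact absurd (intCast_inj_of_lt hij.le hj (add_left_cancel h)) hij.ne
    · exact .inl h
    · exact .inr (.inl (by simpa using h))
    · exact .inr (.inr (by simpa using h))

theorem addEdge_adj {V : Type*} (G : SimpleGraph V) (v w x y : V) :
    (addEdge G v w).Adj x y ↔ G.Adj x y ∨ x ≠ y ∧ ((x = v ∧ y = w) ∨ (x = w ∧ y = v)) := by
  simp only [addEdge, SimpleGraph.sup_adj, SimpleGraph.fromRel_adj]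
  tauto

theorem Umbrella.comp {X Y : Type*} {E : X → X → Prop} {f : X → ℤ} (h : Umbrella E f) (g : Y → X) :
    Umbrella (fun x y => E (g x) (g y)) (f ∘ g) where
  refl _ := h.refl _
  symm _ _ := h.symm _ _
  left _ _ _ := h.left _ _ _
  right _ _ _ := h.right _ _ _

theorem fiber_eq_singleton {V : Type*} {G : SimpleGraph V} {n : ℕ} {r : ZMod n → ℕ}
    {β : V → ZMod n} (hrep : IsRoundRepOf G n r β) {v w : V} (hvw : β v ≠ β w)
    (hnadj : ¬ (roundGraph r).Adj (β v) (β w)) {f : V → ℤ}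
    (hf : Umbrella (fun x y => x = y ∨ (addEdge G v w).Adj x y) f)
    (hdom : IsDominoConf (nearAdd r (β v) (β w)) (β v) (β w)) : β ⁻¹' {β v} = {v} := by
  obtain ⟨-, -, hsurj, hadj⟩ := hrep
  obtain ⟨p, q, c, e, ⟨-, -, -, h4, h5, -⟩, ⟨-, g2, g3, -, g5, g6, -, -⟩, -⟩ := hdom
  obtain ⟨c, rfl⟩ := hsurj c
  obtain ⟨e, rfl⟩ := hsurj e
  ext x
  simp only [Set.mem_preimage, Set.mem_singleton_iff]
  refine ⟨fun hx => ?_, fun hx => by rw [hx]⟩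
  by_contra hne
  simp only [nearAdd, not_or] at h4 h5 g2 g3 g5 g6
  have hcomm := fun x y => (roundGraph r).adj_comm x y
  have ac : β v ≠ β c := by grind
  have ae : β v ≠ β e := by grind
  have bc : β w ≠ β c := by grind
  have be : β w ≠ β e := by grind
  have hEadj : ∀ s t, β s ≠ β t → (roundGraph r).Adj (β s) (β t) →
      (s = t ∨ (addEdge G v w).Adj s t) := fun s t h1 h2 => .inr <| by
    rw [addEdge_adj, hadj s t (fun h => h1 (by rw [h]))]
    exact .inl (.inr h2)
  refine hf.no_square (x := x) (y := c) (z := w) (w := e) (hEadj _ _ (by grind) (by grind))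
    (hEadj _ _ (by grind) (by grind)) (hEadj _ _ (by grind) (by grind))
    (hEadj _ _ (by grind) (by grind)) ?_ ?_
  · rintro (h | h)
    · grind
    · rw [addEdge_adj, hadj x w (by grind)] at h
      grind
  · rintro (h | h)
    · grind
    · rw [addEdge_adj, hadj c e (by grind)] at h
      grind

theorem addEdge_comm {V : Type*} (G : SimpleGraph V) (v w : V) : addEdge G v w = addEdge G w v := by
  ext x y
  rw [addEdge_adj, addEdge_adj]
  tauto

theorem nearAdd_comm {n : ℕ} (r : ZMod n → ℕ) (a b : ZMod n) : nearAdd r a b = nearAdd r b a := by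
  ext x y
  simp only [nearAdd]
  tauto

theorem exists_umbrella_nearAdd {V : Type*} {G : SimpleGraph V} {n : ℕ} {r : ZMod n → ℕ}
    {β : V → ZMod n} (hrep : IsRoundRepOf G n r β) {v w : V} (hvw : β v ≠ β w)
    {f : V → ℤ} (hf : Umbrella (fun x y => x = y ∨ (addEdge G v w).Adj x y) f) :
    ∃ g, Umbrella (nearAdd r (β v) (β w)) g := by
  obtain ⟨-, -, hsurj, hadj⟩ := hrep
  obtain ⟨σ, hσ, hσv, hσw⟩ : ∃ σ : ZMod n → V, (∀ x, β (σ x) = x) ∧ σ (β v) = v ∧ σ (β w) = w := by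
    refine ⟨fun x => if x = β v then v else if x = β w then w else Function.surjInv hsurj x,
      fun x => ?_, by simp, by simp [hvw.symm]⟩
    dsimp only
    split_ifs with h1 h2
    · exact h1.symm
    · exact h2.symm
    · exact Function.surjInv_eq hsurj x
  refine ⟨f ∘ σ, ?_⟩
  convert hf.comp σ using 1
  ext x y
  have hinj : σ x = σ y ↔ x = y := ⟨fun h => by rw [← hσ x, h, hσ], fun h => by rw [h]⟩
  have hv : ∀ x, σ x = v ↔ x = β v := fun x => ⟨fun h => by rw [← h, hσ], fun h => by rw [h, hσv]⟩
  have hw : ∀ x, σ x = w ↔ x = β w := fun x => ⟨fun h => by rw [← h, hσ], fun h => by rw [h, hσw]⟩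
  by_cases hxy : x = y
  · simp [nearAdd, hxy]
  · rw [hinj, addEdge_adj, hadj _ _ (fun h => hxy (hinj.1 h)), hσ, hσ, hv, hw, hv, hw, ne_eq, hinj]
    simp only [nearAdd]
    tauto

theorem stmt14 {V : Type*} [Fintype V] (G : SimpleGraph V) (n : ℕ) (hn : 1 ≤ n)
    (r : ZMod n → ℕ) (β : V → ZMod n) (hbc : IsBlockContigOf G n r β)
    (a b : ZMod n) (hab : a ≠ b) (hnadj : ¬ (roundGraph r).Adj a b)
    (v w : V) (hv : β v = a) (hw : β w = b)
    (hpig : IsPIG (addEdge G v w)) :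
    (AlmostConnectable r β a b ∧ AlmostConnectable r β b a) ∨
    (Connectable r a b ∨ Connectable r b a) := by
  obtain ⟨hrep, hc, -, hconn⟩ := hbc
  have hr := hrep.1
  have : NeZero n := ⟨by omega⟩
  subst hv hw
  obtain ⟨f, hf⟩ := hpig.exists_umbrella
  obtain ⟨g, hg⟩ := exists_umbrella_nearAdd hrep hab hf
  obtain ⟨d, hd, hdn, hbd⟩ : ∃ d : ℤ, 0 < d ∧ d < n ∧ β w = β v + d := by
    refine ⟨(β w - β v).val, ?_, by exact_mod_cast ZMod.val_lt _, by simp⟩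
    have : (β w - β v).val ≠ 0 := by
      rw [ne_eq, ZMod.val_eq_zero, sub_eq_zero]
      exact hab.symm
    omega
  have hconf : ArcConf n d (unrolled r (β v)) (fun i => β v + (i : ZMod n))
      (nearAdd r (β v) (β w)) g := by
    rw [hbd] at hg hnadj ⊢
    exact arcConf_unrolled hr hc hconn hd hdn hnadj hg
  have hsymm : ¬ (roundGraph r).Adj (β w) (β v) := fun h => hnadj h.symm
  rcases hconf.trichotomy with h | h | h
  · right; left
    rw [hbd]
    exact connectable_of_unrolled hr hd hdn hconf.no_left h
  · right; right
    have hT : ∀ i j, unrolled r (β w) i j ↔ unrolled r (β v) (i + d) (j + d) := by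
      intro i j
      simp only [unrolled]
      rw [hbd, show β v + ((i + d : ℤ) : ZMod n) = β v + d + i by push_cast; ring]
      omega
    have hav : β v = β w + ((n - d : ℤ) : ZMod n) := by
      rw [hbd]
      simp
    conv => enter [3]; rw [hav]
    refine connectable_of_unrolled hr (by omega) (by omega) ?_ ?_
    · rw [hT, zero_add, sub_add_cancel]
      exact hconf.no_right
    · intro i hi0 hi
      rw [hT, hT, zero_add, sub_add_cancel]
      exact h (i + d) (by omega) (by omega)
  · left
    have hdom : IsDominoConf (nearAdd r (β v) (β w)) (β v) (β w) := by
      simpa [← hbd] using h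
    have hdom' : IsDominoConf (nearAdd r (β w) (β v)) (β w) (β v) := by
      rw [nearAdd_comm]
      exact hdom.swap hg.symm
    have h1 := fiber_eq_singleton hrep hab hnadj hf hdom
    have h2 := fiber_eq_singleton hrep hab.symm hsymm (by rwa [addEdge_comm]) hdom'
    exact ⟨almostConnectable_of_domino hab hnadj ⟨v, h1⟩ ⟨w, h2⟩ hdom,
      almostConnectable_of_domino hab.symm hsymm ⟨w, h2⟩ ⟨v, h1⟩ hdom'⟩
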